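/- Let 𝔾 be a finite connected transitive graph. Given 0 < λ₁ < λ₂ < ∞, let p₁ and p₂ be defined by χ(p_i) = λ_i V^{1/3} for i = 1, 2 (assuming 1 < λ_i V^{1/3} < V so these are well defined). If ∇̄_{p₂} < 1, then ((λ₂ − λ₁)/(λ₁λ₂))·V^{-1/3} ≤ Ω(p₂ − p₁) ≤ (1/(1 − ∇̄_{p₂}))·((λ₂ − λ₁)/(λ₁λ₂))·V^{-1/3}. -/

import Mathlib

noncomputable section
open Classical

namespace Percolation

variable {V : Type*} [Fintype V] [DecidableEq V]

/-- A percolation configuration: an assignment of occupied (`true`) or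
vacant (`false`) to each bond of the graph. -/
def Config (G : SimpleGraph V) : Type _ := G.edgeSet → Bool

noncomputable instance (G : SimpleGraph V) : Fintype G.edgeSet :=
  Fintype.ofFinite _

noncomputable instance (G : SimpleGraph V) : Fintype (Config G) :=
  inferInstanceAs (Fintype (G.edgeSet → Bool))

/-- The probability weight of a configuration under the product Bernoulli
measure with parameter `p`. -/
def weight (G : SimpleGraph V) (p : ℝ) (ω : Config G) : ℝ :=
  ∏ e : G.edgeSet, if ω e then p else 1 - p

/-- The probability of an event under the percolation measure `ℙ_p`. -/
def prob (G : SimpleGraph V) (p : ℝ) (A : Config G → Prop) : ℝ :=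
  ∑ ω : Config G, if A ω then weight G p ω else 0

/-- The expectation of a random variable under the percolation measure `ℙ_p`. -/
def expect (G : SimpleGraph V) (p : ℝ) (f : Config G → ℝ) : ℝ :=
  ∑ ω : Config G, weight G p ω * f ω

/-- The subgraph consisting of the occupied bonds of a configuration. -/
def occupied (G : SimpleGraph V) (ω : Config G) : SimpleGraph V :=
  SimpleGraph.fromEdgeSet {e | ∃ h : e ∈ G.edgeSet, ω ⟨e, h⟩ = true}

/-- The cluster `C(x)` of the vertex `x`: all vertices joined to `x` by a path
of occupied bonds (including `x` itself). -/
def cluster (G : SimpleGraph V) (ω : Config G) (x : V) : Finset V :=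
  Finset.univ.filter fun y => (occupied G ω).Reachable x y

/-- The susceptibility `χ(p)`: the expected size of the cluster of `x₀`. -/
def chi (G : SimpleGraph V) (x₀ : V) (p : ℝ) : ℝ :=
  expect G p fun ω => ((cluster G ω x₀).card : ℝ)

/-- The two-point function `τ_p(x,y) = ℙ_p(x ↔ y)`. -/
def tau (G : SimpleGraph V) (p : ℝ) (x y : V) : ℝ :=
  prob G p fun ω => (occupied G ω).Reachable x y

/-- The triangle diagram `∇_p(x,y)`. -/
def triangle (G : SimpleGraph V) (p : ℝ) (x y : V) : ℝ :=
  ∑ u : V, ∑ v : V, tau G p x u * tau G p u v * tau G p v y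

/-- The Kronecker delta `δ_{x,y}`. -/
def kron (x y : V) : ℝ := if x = y then 1 else 0

/-- `∇̄_p`: the maximum of the triangle diagram over bonds `{x,y} ∈ 𝔹`. -/
def nablaBar (G : SimpleGraph V) (p : ℝ) : ℝ :=
  sSup {t : ℝ | ∃ x y : V, G.Adj x y ∧ t = triangle G p x y}

/-- A graph is (vertex-)transitive if any vertex can be mapped to any other
by a graph automorphism. -/
def IsTransitive (G : SimpleGraph V) : Prop :=
  ∀ x y : V, ∃ φ : G ≃g G, φ x = y

/-- The size `|C_max|` of the largest cluster. -/
def maxCluster (G : SimpleGraph V) (ω : Config G) : ℕ :=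
  Finset.univ.sup fun x => (cluster G ω x).card

/-- The cluster size distribution `P_{≥k}(p) = ℙ_p(|C(x₀)| ≥ k)`. -/
def Pgeq (G : SimpleGraph V) (x₀ : V) (p : ℝ) (k : ℝ) : ℝ :=
  prob G p fun ω => k ≤ ((cluster G ω x₀).card : ℝ)

/-- The magnetization `M(p,γ)`. -/
def magnetization (G : SimpleGraph V) (x₀ : V) (p γ : ℝ) : ℝ :=
  ∑ k ∈ Finset.Icc 1 (Fintype.card V),
    (1 - (1 - γ) ^ k) * prob G p fun ω => (cluster G ω x₀).card = k

/-- `Z_{≥s}`: the number of vertices lying in clusters of size at least `s`. -/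
def Zgeq (G : SimpleGraph V) (s : ℝ) (ω : Config G) : ℝ :=
  ∑ x : V, if s ≤ ((cluster G ω x).card : ℝ) then (1 : ℝ) else 0

/-- The variance of a random variable under `ℙ_p`. -/
def variance (G : SimpleGraph V) (p : ℝ) (f : Config G → ℝ) : ℝ :=
  expect G p (fun ω => f ω ^ 2) - (expect G p f) ^ 2

/-- The restricted susceptibility `χ_{≥s}(p) = 𝔼_p[|C(x₀)| I[|C(x₀)| ≥ s]]`. -/
def chiGeq (G : SimpleGraph V) (x₀ : V) (p : ℝ) (s : ℝ) : ℝ :=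
  expect G p fun ω =>
    if s ≤ ((cluster G ω x₀).card : ℝ) then ((cluster G ω x₀).card : ℝ) else 0

/-- The restricted susceptibility `χ_{<s}(p) = 𝔼_p[|C(x₀)| I[|C(x₀)| < s]]`. -/
def chiLt (G : SimpleGraph V) (x₀ : V) (p : ℝ) (s : ℝ) : ℝ :=
  expect G p fun ω =>
    if ((cluster G ω x₀).card : ℝ) < s then ((cluster G ω x₀).card : ℝ) else 0

end Percolation
namespace PercAux

section Generic
variable {α : Type*} [DecidableEq α]

def ind (P : Prop) : ℝ := if P then 1 else 0

lemma ind_true {P : Prop} (h : P) : ind P = 1 := by simp [ind, h]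
lemma ind_false {P : Prop} (h : ¬ P) : ind P = 0 := by simp [ind, h]
lemma ind_nonneg (P : Prop) : 0 ≤ ind P := by unfold ind; split_ifs <;> norm_num
lemma ind_le_one (P : Prop) : ind P ≤ 1 := by unfold ind; split_ifs <;> norm_num
lemma ind_mono {P Q : Prop} (h : P → Q) : ind P ≤ ind Q := by
  by_cases hP : P
  · rw [ind_true hP, ind_true (h hP)]
  · rw [ind_false hP]; exact ind_nonneg _
lemma ind_congr {P Q : Prop} (h : P ↔ Q) : ind P = ind Q := by rw [propext h]
lemma ind_and (P Q : Prop) : ind (P ∧ Q) = ind P * ind Q := by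
  by_cases hP : P <;> by_cases hQ : Q <;> simp [ind, hP, hQ]

/-- Bernoulli expectation on subsets of `E`. -/
def M (p : ℝ) (E : Finset α) (f : Finset α → ℝ) : ℝ :=
  ∑ s ∈ E.powerset, (∏ e ∈ E, if e ∈ s then p else 1 - p) * f s

lemma M_empty (p : ℝ) (f : Finset α → ℝ) : M p ∅ f = f ∅ := by simp [M]

lemma M_insert (p : ℝ) {a : α} {E : Finset α} (h : a ∉ E) (f : Finset α → ℝ) :
    M p (insert a E) f = (1 - p) * M p E f + p * M p E (fun s => f (insert a s)) := by
  unfold M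
  rw [Finset.sum_powerset_insert h, Finset.mul_sum, Finset.mul_sum]
  congr 1
  · refine Finset.sum_congr rfl fun s hs => ?_
    have : a ∉ s := fun h' => h (Finset.mem_powerset.1 hs h')
    rw [Finset.prod_insert h, if_neg this, mul_assoc]
  · refine Finset.sum_congr rfl fun s hs => ?_
    rw [Finset.prod_insert h, if_pos (Finset.mem_insert_self _ _), mul_assoc]
    congr 2
    refine Finset.prod_congr rfl fun e he => ?_
    have : e ≠ a := fun h' => h (h' ▸ he)
    simp [this]

lemma M_mono {p : ℝ} (h0 : 0 ≤ p) (h1 : p ≤ 1) (E : Finset α) {f g : Finset α → ℝ}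
    (h : ∀ s, f s ≤ g s) : M p E f ≤ M p E g := by
  unfold M
  refine Finset.sum_le_sum fun s _ => mul_le_mul_of_nonneg_left (h s) ?_
  refine Finset.prod_nonneg fun e _ => ?_
  split_ifs <;> linarith

lemma M_add (p : ℝ) (E : Finset α) (f g : Finset α → ℝ) :
    M p E (fun s => f s + g s) = M p E f + M p E g := by
  simp [M, mul_add, Finset.sum_add_distrib]

lemma M_sub (p : ℝ) (E : Finset α) (f g : Finset α → ℝ) :
    M p E (fun s => f s - g s) = M p E f - M p E g := by
  simp [M, mul_sub, Finset.sum_sub_distrib]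

lemma M_mul (p : ℝ) (E : Finset α) (c : ℝ) (f : Finset α → ℝ) :
    M p E (fun s => c * f s) = c * M p E f := by
  simp only [M, Finset.mul_sum]
  exact Finset.sum_congr rfl fun s _ => by ring

lemma M_mul' (p : ℝ) (E : Finset α) (c : ℝ) (f : Finset α → ℝ) :
    M p E (fun s => f s * c) = M p E f * c := by
  simp only [M, Finset.sum_mul]
  exact Finset.sum_congr rfl fun s _ => by ring

lemma M_sum {ι : Type*} (p : ℝ) (E : Finset α) (I : Finset ι) (f : ι → Finset α → ℝ) :
    M p E (fun s => ∑ i ∈ I, f i s) = ∑ i ∈ I, M p E (f i) := by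
  simp only [M, Finset.mul_sum]
  rw [Finset.sum_comm]

lemma M_const (p : ℝ) (E : Finset α) (c : ℝ) : M p E (fun _ => c) = c := by
  induction E using Finset.induction_on with
  | empty => rw [M_empty]
  | insert a E ha ih => rw [M_insert p ha, ih]; ring

lemma M_nonneg {p : ℝ} (h0 : 0 ≤ p) (h1 : p ≤ 1) (E : Finset α) {f : Finset α → ℝ}
    (h : ∀ s, 0 ≤ f s) : 0 ≤ M p E f := by
  have := M_mono h0 h1 E h
  rwa [M_const] at this

lemma M_indep (p : ℝ) (T : α → Prop) (E : Finset α) :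
    ∀ (f g : Finset α → ℝ), (∀ e s, ¬ T e → f (insert e s) = f s) →
      (∀ e s, T e → g (insert e s) = g s) →
      M p E (fun s => f s * g s) = M p E f * M p E g := by
  induction E using Finset.induction_on with
  | empty => intro f g _ _; simp only [M_empty]
  | insert a E ha ih =>
    intro f g hf hg
    rw [M_insert p ha, M_insert p ha, M_insert p ha, ih f g hf hg]
    by_cases hT : T a
    · simp only [hg a _ hT]
      rw [ih (fun s => f (insert a s)) g ?_ hg]
      · ring
      · intro e s he
        rw [Finset.insert_comm, hf e _ he]
    · simp only [hf a _ hT]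
      rw [ih f (fun s => g (insert a s)) hf ?_]
      · ring
      · intro e s he
        rw [Finset.insert_comm, hg e _ he]

lemma M_congr (p : ℝ) (E : Finset α) {f g : Finset α → ℝ} (h : ∀ s, s ⊆ E → f s = g s) :
    M p E f = M p E g := by
  unfold M
  exact Finset.sum_congr rfl fun s hs => by rw [h s (Finset.mem_powerset.1 hs)]

/-- Russo's formula. -/
lemma M_deriv (p : ℝ) (E : Finset α) : ∀ f : Finset α → ℝ,
    HasDerivAt (fun p => M p E f)
      (∑ e ∈ E, M p E (fun s => f (insert e s) - f (s.erase e))) p := by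
  induction E using Finset.induction_on with
  | empty => intro f; simp only [M_empty]; simpa using hasDerivAt_const p (f ∅)
  | insert a E ha ih =>
    intro f
    have h1 := ih f
    have h2 := ih (fun s => f (insert a s))
    have h3 : HasDerivAt (fun p : ℝ => 1 - p) (-1) p := by
      simpa using (hasDerivAt_id p).const_sub 1
    have h := (h3.mul h1).add ((hasDerivAt_id p).mul h2)
    have hfun : (fun p => M p (insert a E) f) =
        ((fun p : ℝ => 1 - p) * fun p => M p E f) + (id * fun p => M p E fun s => f (insert a s)) := by
      funext q
      simp [M_insert q ha]
    rw [hfun]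
    refine h.congr_deriv (Eq.symm ?_)
    rw [Finset.sum_insert ha, M_insert p ha]
    have e1 : M p E (fun s => f (insert a s) - f (s.erase a)) =
        M p E (fun s => f (insert a s)) - M p E f := by
      rw [← M_sub]
      refine M_congr p E fun s hs => ?_
      rw [Finset.erase_eq_of_notMem fun h' => ha (hs h')]
    have e2 : M p E (fun s => f (insert a (insert a s)) - f ((insert a s).erase a)) =
        M p E (fun s => f (insert a s)) - M p E f := by
      rw [← M_sub]
      refine M_congr p E fun s hs => ?_
      rw [Finset.erase_insert fun h' => ha (hs h'), Finset.insert_idem]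
    have e3 : ∑ e ∈ E, M p (insert a E) (fun s => f (insert e s) - f (s.erase e)) =
        (1 - p) * ∑ e ∈ E, M p E (fun s => f (insert e s) - f (s.erase e)) +
        p * ∑ e ∈ E, M p E (fun s => f (insert a (insert e s)) - f (insert a (s.erase e))) := by
      rw [Finset.mul_sum, Finset.mul_sum, ← Finset.sum_add_distrib]
      refine Finset.sum_congr rfl fun e he => ?_
      rw [M_insert p ha]
      congr 3
      funext s
      have : a ≠ e := fun h' => ha (h' ▸ he)
      rw [Finset.insert_comm, Finset.erase_insert_of_ne this]
    rw [e1, e2, e3]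
    simp only [id]
    ring

lemma M_map (p : ℝ) (σ : α ↪ α) (E : Finset α) : ∀ f : Finset α → ℝ,
    M p (E.map σ) f = M p E (fun s => f (s.map σ)) := by
  induction E using Finset.induction_on with
  | empty => intro f; simp [M_empty]
  | insert a E ha ih =>
    intro f
    have : σ a ∉ E.map σ := by simpa using ha
    rw [Finset.map_insert, M_insert p this, M_insert p ha, ih, ih]
    simp only [Finset.map_insert]

/-- disjoint occurrence -/
def D (H : Finset α → Finset α → Prop) (s : Finset α) : Prop :=
  ∃ I J, Disjoint I J ∧ I ⊆ s ∧ J ⊆ s ∧ H I J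

lemma BK {p : ℝ} (h0 : 0 ≤ p) (h1 : p ≤ 1) (E : Finset α) :
    ∀ H : Finset α → Finset α → Prop,
      (∀ I J I' J', I ⊆ I' → J ⊆ J' → H I J → H I' J') →
      M p E (fun s => ind (D H s)) ≤ M p E (fun s => M p E (fun t => ind (H s t))) := by
  induction E using Finset.induction_on with
  | empty =>
    intro H hH
    simp only [M_empty]
    refine ind_mono ?_
    rintro ⟨I, J, -, hI, hJ, h⟩
    exact hH _ _ _ _ hI hJ h
  | insert a E ha ih =>
    intro H hH
    have hI : ∀ s : Finset α, s ⊆ insert a s := fun s => Finset.subset_insert a s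
    let H' : Finset α → Finset α → Prop := fun I J => H (insert a I) J ∨ H I (insert a J)
    have hH' : ∀ I J I' J', I ⊆ I' → J ⊆ J' → H' I J → H' I' J' := by
      rintro I J I' J' h h' (hh | hh)
      · exact Or.inl (hH _ _ _ _ (Finset.insert_subset_insert a h) h' hh)
      · exact Or.inr (hH _ _ _ _ h (Finset.insert_subset_insert a h') hh)
    have key : ∀ s, ind (D H (insert a s)) ≤ ind (D H' s) := by
      intro s
      refine ind_mono ?_
      rintro ⟨I, J, hd, hIs, hJs, h⟩
      have sub : ∀ K : Finset α, K ⊆ insert a s → a ∉ K → K ⊆ s := fun K hK haK =>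
        (Finset.subset_insert_iff_of_notMem haK).1 hK
      by_cases haI : a ∈ I
      · have haJ : a ∉ J := Finset.disjoint_left.1 hd haI
        refine ⟨I.erase a, J, Finset.disjoint_of_subset_left (Finset.erase_subset _ _) hd,
          Finset.subset_insert_iff.1 hIs, sub J hJs haJ, Or.inl ?_⟩
        rwa [Finset.insert_erase haI]
      · by_cases haJ : a ∈ J
        · refine ⟨I, J.erase a, Finset.disjoint_of_subset_right (Finset.erase_subset _ _) hd,
            sub I hIs haI, Finset.subset_insert_iff.1 hJs, Or.inr ?_⟩
          rwa [Finset.insert_erase haJ]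
        · exact ⟨I, J, hd, sub I hIs haI, sub J hJs haJ,
            Or.inl (hH _ _ _ _ (hI I) (Finset.Subset.refl _) h)⟩
    have i1 := ih H hH
    have i2 := (M_mono h0 h1 E key).trans (ih H' hH')
    have hr : M p (insert a E) (fun s => M p (insert a E) (fun t => ind (H s t))) =
        M p E (fun s => M p E (fun t => (1 - p) * ((1 - p) * ind (H s t) + p * ind (H s (insert a t)))
          + p * ((1 - p) * ind (H (insert a s) t) + p * ind (H (insert a s) (insert a t))))) := by
      simp only [M_insert p ha, M_add, M_mul]
    have hl : (1 - p) * M p E (fun s => M p E (fun t => ind (H s t))) +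
        p * M p E (fun s => M p E (fun t => ind (H' s t))) =
        M p E (fun s => M p E (fun t => (1 - p) * ind (H s t) + p * ind (H' s t))) := by
      simp only [M_add, M_mul]
    rw [M_insert p ha, hr]
    refine le_trans (b := (1 - p) * M p E (fun s => M p E (fun t => ind (H s t))) +
        p * M p E (fun s => M p E (fun t => ind (H' s t)))) ?_ ?_
    · exact add_le_add (mul_le_mul_of_nonneg_left i1 (by linarith))
        (mul_le_mul_of_nonneg_left i2 h0)
    · rw [hl]
      refine M_mono h0 h1 E fun s => M_mono h0 h1 E fun t => ?_
      have a1 : H s t → H (insert a s) t := hH _ _ _ _ (hI s) (Finset.Subset.refl _)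
      have a2 : H s t → H s (insert a t) := hH _ _ _ _ (Finset.Subset.refl _) (hI t)
      have a3 : H (insert a s) t → H (insert a s) (insert a t) :=
        hH _ _ _ _ (Finset.Subset.refl _) (hI t)
      have a4 : H s (insert a t) → H (insert a s) (insert a t) :=
        hH _ _ _ _ (hI s) (Finset.Subset.refl _)
      have hpp : 0 ≤ p * (1 - p) := mul_nonneg h0 (by linarith)
      by_cases b0 : H s t
      · have b1 := a1 b0
        have b2 := a2 b0
        have b3 := a3 b1
        simp only [H', ind, b0, b1, b2, b3, or_true, if_true]
        nlinarith
      · by_cases b1 : H (insert a s) t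
        · have b3 := a3 b1
          by_cases b2 : H s (insert a t)
          · simp only [H', ind, b0, b1, b2, b3, or_true, if_true, if_false]; nlinarith
          · simp only [H', ind, b0, b1, b2, b3, or_false, if_true, if_false]; nlinarith
        · by_cases b2 : H s (insert a t)
          · have b3 := a4 b2
            simp only [H', ind, b0, b1, b2, b3, or_true, if_true, if_false]; nlinarith
          · have := ind_nonneg (H (insert a s) (insert a t))
            have : 0 ≤ p * (p * ind (H (insert a s) (insert a t))) := by positivity
            simp only [H', ind, b0, b1, b2, or_self, if_false] at this ⊢
            linarith

def Inc (A : Finset α → Prop) : Prop := ∀ s t, s ⊆ t → A s → A t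

def box (A B : Finset α → Prop) : Finset α → Prop := D (fun I J => A I ∧ B J)

lemma box_inc (A B : Finset α → Prop) : Inc (box A B) := by
  rintro s t hst ⟨I, J, hd, hI, hJ, h⟩
  exact ⟨I, J, hd, hI.trans hst, hJ.trans hst, h⟩

lemma BK' {p : ℝ} (h0 : 0 ≤ p) (h1 : p ≤ 1) (E : Finset α) {A B : Finset α → Prop}
    (hA : Inc A) (hB : Inc B) :
    M p E (fun s => ind (box A B s)) ≤ M p E (fun s => ind (A s)) * M p E (fun s => ind (B s)) := by
  refine (BK h0 h1 E _ ?_).trans ?_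
  · rintro I J I' J' h h' ⟨x, y⟩
    exact ⟨hA _ _ h x, hB _ _ h' y⟩
  · simp only [ind_and, M_mul, M_mul']
    exact le_rfl

lemma M_mono_p {E : Finset α} {A : Finset α → Prop} (hA : Inc A) :
    MonotoneOn (fun p => M p E (fun s => ind (A s))) (Set.Icc 0 1) := by
  refine monotoneOn_of_deriv_nonneg (convex_Icc 0 1) ?_ ?_ ?_
  · exact fun p _ => (M_deriv p E _).continuousAt.continuousWithinAt
  · exact fun p _ => (M_deriv p E _).differentiableAt.differentiableWithinAt
  · intro p hp
    rw [interior_Icc] at hp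
    rw [(M_deriv p E _).deriv]
    refine Finset.sum_nonneg fun e _ => M_nonneg hp.1.le hp.2.le E fun s => ?_
    have : ind (A (s.erase e)) ≤ ind (A (insert e s)) :=
      ind_mono (hA _ _ ((Finset.erase_subset _ _).trans (Finset.subset_insert _ _)))
    linarith

end Generic

section Graph
variable {V : Type*} [Fintype V] [DecidableEq V]

abbrev gr (s : Finset (Sym2 V)) : SimpleGraph V := SimpleGraph.fromEdgeSet (s : Set (Sym2 V))

def reach (s : Finset (Sym2 V)) (x y : V) : Prop := (gr s).Reachable x y

lemma reach_refl (s : Finset (Sym2 V)) (x : V) : reach s x x := SimpleGraph.Reachable.refl x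

lemma reach_symm {s : Finset (Sym2 V)} {x y : V} (h : reach s x y) : reach s y x :=
  SimpleGraph.Reachable.symm h

lemma reach_trans {s : Finset (Sym2 V)} {x y z : V} (h : reach s x y) (h' : reach s y z) :
    reach s x z := SimpleGraph.Reachable.trans h h'

lemma reach_mono {s t : Finset (Sym2 V)} (h : s ⊆ t) {x y : V} (hr : reach s x y) :
    reach t x y :=
  SimpleGraph.Reachable.mono (SimpleGraph.fromEdgeSet_mono (by exact_mod_cast h)) hr

lemma reach_inc (x y : V) : Inc (fun s => reach s x y) := fun _ _ h hr => reach_mono h hr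

lemma reach_edge {s : Finset (Sym2 V)} {x y : V} (h : s(x, y) ∈ s) : reach s x y := by
  by_cases hxy : x = y
  · subst hxy; exact reach_refl _ _
  · exact SimpleGraph.Adj.reachable (by simp [hxy, h])

/-- Induction principle for reachability. -/
lemma reach_ind {s : Finset (Sym2 V)} {y : V} {P : V → Prop} (hy : P y)
    (hs : ∀ a b, s(a, b) ∈ s → reach s b y → P b → P a) {x : V} (h : reach s x y) : P x := by
  obtain ⟨w⟩ := h
  induction w with
  | nil => exact hy
  | cons hab w ih =>
    rw [SimpleGraph.fromEdgeSet_adj] at hab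
    exact hs _ _ (by exact_mod_cast hab.1) ⟨w⟩ (ih hy hs)

lemma reach_insert {s : Finset (Sym2 V)} {u v x y : V} (h : reach (insert s(u, v) s) x y) :
    reach s x y ∨ (reach s x u ∧ reach s v y) ∨ (reach s x v ∧ reach s u y) := by
  refine reach_ind (s := insert s(u, v) s) (y := y)
    (P := fun x => reach s x y ∨ (reach s x u ∧ reach s v y) ∨ (reach s x v ∧ reach s u y))
    (Or.inl (reach_refl _ _)) ?_ h
  intro a b hab _ hb
  rcases Finset.mem_insert.1 hab with h | h
  · rcases Sym2.eq_iff.1 h with ⟨rfl, rfl⟩ | ⟨rfl, rfl⟩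
    · rcases hb with hb | ⟨-, hb⟩ | ⟨-, hb⟩
      · exact Or.inr (Or.inl ⟨reach_refl _ _, hb⟩)
      · exact Or.inr (Or.inl ⟨reach_refl _ _, hb⟩)
      · exact Or.inl hb
    · rcases hb with hb | ⟨-, hb⟩ | ⟨-, hb⟩
      · exact Or.inr (Or.inr ⟨reach_refl _ _, hb⟩)
      · exact Or.inl hb
      · exact Or.inr (Or.inr ⟨reach_refl _ _, hb⟩)
  · have := reach_edge h
    rcases hb with hb | ⟨hb, h'⟩ | ⟨hb, h'⟩
    · exact Or.inl (reach_trans this hb)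
    · exact Or.inr (Or.inl ⟨reach_trans this hb, h'⟩)
    · exact Or.inr (Or.inr ⟨reach_trans this hb, h'⟩)

/-- edges with all endpoints satisfying `P` -/
def filt (P : V → Prop) (s : Finset (Sym2 V)) : Finset (Sym2 V) :=
  @Finset.filter _ (fun e => ∀ z ∈ e, P z) (fun _ => Classical.propDecidable _) s

lemma mem_filt {P : V → Prop} {s : Finset (Sym2 V)} {e : Sym2 V} :
    e ∈ filt P s ↔ e ∈ s ∧ ∀ z ∈ e, P z := by simp [filt]

lemma filt_subset (P : V → Prop) (s : Finset (Sym2 V)) : filt P s ⊆ s :=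
  fun _ he => (mem_filt.1 he).1

/-- a connection within a class of vertices closed under edges -/
lemma reach_filter {s : Finset (Sym2 V)} {P : V → Prop}
    (hP : ∀ a b, s(a, b) ∈ s → (P a ↔ P b)) {x y : V} (hx : P y) (h : reach s x y) :
    reach (filt P s) x y := by
  have : P x ∧ reach (filt P s) x y := by
    refine reach_ind (s := s) (y := y)
      (P := fun x => P x ∧ reach (filt P s) x y) ⟨hx, reach_refl _ _⟩ ?_ h
    rintro a b hab - ⟨hb, hr⟩
    have ha := (hP a b hab).2 hb
    refine ⟨ha, reach_trans (reach_edge ?_) hr⟩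
    simp [mem_filt, hab, ha, hb]
  exact this.2

lemma reach_box {s : Finset (Sym2 V)} {x u v y : V} (h1 : reach s x u) (h2 : reach s v y)
    (h3 : ¬ reach s x v) : box (fun s => reach s x u) (fun s => reach s v y) s := by
  have hy : ¬ reach s x y := fun h => h3 (reach_trans h (reach_symm h2))
  have c1 : ∀ a b, s(a, b) ∈ s → (reach s x a ↔ reach s x b) := fun a b hab =>
    ⟨fun h => reach_trans h (reach_edge hab), fun h => reach_trans h (reach_symm (reach_edge hab))⟩
  refine ⟨_, _, ?_, filt_subset _ _, filt_subset _ _,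
    reach_filter (P := fun z => reach s x z) c1 h1 h1,
    reach_filter (P := fun z => ¬ reach s x z) (fun a b hab => not_congr (c1 a b hab)) hy h2⟩
  rw [Finset.disjoint_left]
  intro e he he'
  rw [mem_filt] at he he'
  induction e with
  | _ a b => exact he'.2 a (by simp) (he.2 a (by simp))

/-- edges of a walk -/
lemma walk_reach {s : Finset (Sym2 V)} {x y : V} (w : (gr s).Walk x y) :
    w.edges.toFinset ⊆ s ∧ reach w.edges.toFinset x y := by
  induction w with
  | nil => exact ⟨by simp, reach_refl _ _⟩
  | cons hab w ih =>
    rw [SimpleGraph.fromEdgeSet_adj] at hab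
    refine ⟨?_, ?_⟩
    · rw [SimpleGraph.Walk.edges_cons, List.toFinset_cons, Finset.insert_subset_iff]
      exact ⟨by exact_mod_cast hab.1, ih.1⟩
    · rw [SimpleGraph.Walk.edges_cons, List.toFinset_cons]
      exact reach_trans (reach_edge (Finset.mem_insert_self _ _))
        (reach_mono (Finset.subset_insert _ _) ih.2)

lemma path_box {s : Finset (Sym2 V)} {x y z : V} (w : (gr s).Walk x y) (hw : w.IsPath)
    (hz : z ∈ w.support) :
    box (fun s => reach s x z) (fun s => reach s z y) w.edges.toFinset := by
  have hsplit := w.take_spec hz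
  have he : w.edges = (w.takeUntil z hz).edges ++ (w.dropUntil z hz).edges := by
    rw [← SimpleGraph.Walk.edges_append, hsplit]
  have hnd : w.edges.Nodup := hw.isTrail.edges_nodup
  rw [he] at hnd ⊢
  refine ⟨(w.takeUntil z hz).edges.toFinset, (w.dropUntil z hz).edges.toFinset, ?_, ?_, ?_,
    (walk_reach _).2, (walk_reach _).2⟩
  · rw [List.disjoint_toFinset_iff_disjoint]
    exact List.disjoint_of_nodup_append hnd
  · intro e; simp only [List.mem_toFinset, List.mem_append]; exact Or.inl
  · intro e; simp only [List.mem_toFinset, List.mem_append]; exact Or.inr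

lemma support_reach {s : Finset (Sym2 V)} {P : V → Prop} {x y : V} (w : (gr s).Walk x y)
    (hP : ∀ z ∈ w.support, P z) : reach (filt P s) x y := by
  refine reach_mono ?_ (walk_reach w).2
  intro e he
  rw [mem_filt]
  refine ⟨(walk_reach w).1 he, fun z hz => hP z ?_⟩
  exact SimpleGraph.Walk.mem_support_of_mem_edges (List.mem_toFinset.1 he) hz

lemma off_box {s : Finset (Sym2 V)} {v y : V} (S : Finset V) (h : reach s v y)
    (h' : ¬ (v ∉ S ∧ reach (filt (fun z => z ∉ S) s) v y)) :
    ∃ w ∈ S, box (fun s => reach s v w) (fun s => reach s w y) s := by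
  obtain ⟨w, hw⟩ := SimpleGraph.Reachable.exists_isPath h
  by_contra hc
  push Not at hc
  have : ∀ z ∈ w.support, z ∉ S := fun z hz hzS =>
    hc z hzS (box_inc _ _ _ _ (walk_reach w).1 (path_box w hw hz))
  exact h' ⟨this v (SimpleGraph.Walk.start_mem_support w), support_reach w this⟩

lemma tree_box {s : Finset (Sym2 V)} {x u w : V} (h1 : reach s x u) (h2 : reach s x w) :
    ∃ z, box (box (fun s => reach s x z) (fun s => reach s z u)) (fun s => reach s z w) s := by
  obtain ⟨q, hq⟩ := SimpleGraph.Reachable.exists_isPath h1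
  have : ∃ z, z ∈ q.support ∧ reach (s.filter (fun e => ¬ ∀ a ∈ e, a ∈ q.support)) w z := by
    refine reach_ind (s := s) (y := x)
      (P := fun w => ∃ z, z ∈ q.support ∧
        reach (s.filter (fun e => ¬ ∀ a ∈ e, a ∈ q.support)) w z)
      ⟨x, SimpleGraph.Walk.start_mem_support q, reach_refl _ _⟩ ?_ (reach_symm h2)
    rintro a b hab - ⟨z, hz, hr⟩
    by_cases ha : a ∈ q.support
    · exact ⟨a, ha, reach_refl _ _⟩
    · refine ⟨z, hz, reach_trans (reach_edge ?_) hr⟩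
      simp [hab, ha]
  obtain ⟨z, hz, hr⟩ := this
  refine ⟨z, q.edges.toFinset, s.filter (fun e => ¬ ∀ a ∈ e, a ∈ q.support), ?_,
    (walk_reach q).1, Finset.filter_subset _ _, path_box q hq hz, reach_symm hr⟩
  rw [Finset.disjoint_left]
  intro e he he'
  exact (Finset.mem_filter.1 he').2 fun a ha =>
    SimpleGraph.Walk.mem_support_of_mem_edges (List.mem_toFinset.1 he) ha

/-- two-point function -/
def T (p : ℝ) (E : Finset (Sym2 V)) (x y : V) : ℝ := M p E (fun s => ind (reach s x y))

lemma T_symm (p : ℝ) (E : Finset (Sym2 V)) (x y : V) : T p E x y = T p E y x := by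
  unfold T
  congr 1
  funext s
  exact ind_congr ⟨reach_symm, reach_symm⟩

lemma T_self (p : ℝ) (E : Finset (Sym2 V)) (x : V) : T p E x x = 1 := by
  unfold T
  simp only [ind_true (reach_refl _ x), M_const]

lemma T_nonneg {p : ℝ} (h0 : 0 ≤ p) (h1 : p ≤ 1) (E : Finset (Sym2 V)) (x y : V) :
    0 ≤ T p E x y := M_nonneg h0 h1 E fun _ => ind_nonneg _

lemma ind_exists_le {ι : Type*} {S : Finset ι} {P : Prop} {Q : ι → Prop}
    (h : P → ∃ i ∈ S, Q i) : ind P ≤ ∑ i ∈ S, ind (Q i) := by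
  by_cases hP : P
  · obtain ⟨i, hi, hQ⟩ := h hP
    rw [ind_true hP, ← ind_true hQ]
    exact Finset.single_le_sum (f := fun i => ind (Q i)) (fun i _ => ind_nonneg _) hi
  · rw [ind_false hP]
    exact Finset.sum_nonneg fun i _ => ind_nonneg _

lemma tree_graph {p : ℝ} (h0 : 0 ≤ p) (h1 : p ≤ 1) (E : Finset (Sym2 V)) (x u w : V) :
    M p E (fun s => ind (reach s x u ∧ reach s x w)) ≤
      ∑ z, T p E x z * T p E z u * T p E z w := by
  refine (M_mono h0 h1 E (g := fun s => ∑ z, ind (box (box (fun s => reach s x z)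
    (fun s => reach s z u)) (fun s => reach s z w) s)) fun s => ind_exists_le ?_).trans ?_
  · rintro ⟨a, b⟩
    obtain ⟨z, hz⟩ := tree_box a b
    exact ⟨z, Finset.mem_univ _, hz⟩
  · rw [M_sum]
    refine Finset.sum_le_sum fun z _ => ?_
    refine (BK' h0 h1 E (box_inc _ _) (reach_inc z w)).trans ?_
    exact mul_le_mul_of_nonneg_right (BK' h0 h1 E (reach_inc x z) (reach_inc z u))
      (T_nonneg h0 h1 E z w)

lemma off_bound {p : ℝ} (h0 : 0 ≤ p) (h1 : p ≤ 1) (E : Finset (Sym2 V)) (v y : V)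
    (S : Finset V) :
    T p E v y - ∑ w ∈ S, T p E v w * T p E w y ≤
      M p E (fun s => ind (v ∉ S ∧ reach (filt (fun z => z ∉ S) s) v y)) := by
  have : T p E v y ≤ M p E (fun s =>
      ind (v ∉ S ∧ reach (filt (fun z => z ∉ S) s) v y) +
      ∑ w ∈ S, ind (box (fun s => reach s v w) (fun s => reach s w y) s)) := by
    refine M_mono h0 h1 E fun s => ?_
    by_cases h' : v ∉ S ∧ reach (filt (fun z => z ∉ S) s) v y
    · rw [ind_true h']
      have := Finset.sum_nonneg (s := S) (f := fun w => ind (box (fun s => reach s v w) (fun s => reach s w y) s))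
        fun i _ => ind_nonneg _
      have := ind_le_one (reach s v y)
      linarith
    · rw [ind_false h', zero_add]
      exact ind_exists_le fun h => off_box S h h'
  rw [M_add, M_sum] at this
  have h2 : ∑ w ∈ S, M p E (fun s => ind (box (fun s => reach s v w) (fun s => reach s w y) s)) ≤
      ∑ w ∈ S, T p E v w * T p E w y :=
    Finset.sum_le_sum fun w _ => BK' h0 h1 E (reach_inc v w) (reach_inc w y)
  linarith

def cl (s : Finset (Sym2 V)) (x : V) : Finset V := Finset.univ.filter (fun y => reach s x y)

lemma mem_cl {s : Finset (Sym2 V)} {x y : V} : y ∈ cl s x ↔ reach s x y := by simp [cl]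

lemma cl_insert {s : Finset (Sym2 V)} {x : V} {S : Finset V} {e : Sym2 V}
    (he : ∀ z ∈ e, z ∉ S) : cl (insert e s) x = S ↔ cl s x = S := by
  induction e with
  | _ u v =>
  have hu : u ∉ S := he u (by simp)
  have hv : v ∉ S := he v (by simp)
  have key : ¬ reach s x u → ¬ reach s x v → cl (insert s(u, v) s) x = cl s x := by
    intro a b
    ext z
    rw [mem_cl, mem_cl]
    refine ⟨fun h => ?_, reach_mono (Finset.subset_insert _ _)⟩
    rcases reach_insert h with h | ⟨h, -⟩ | ⟨h, -⟩
    · exact h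
    · exact absurd h a
    · exact absurd h b
  constructor
  · intro h
    rw [← key, h]
    · intro h'; exact hu (h ▸ mem_cl.2 (reach_mono (Finset.subset_insert _ _) h'))
    · intro h'; exact hv (h ▸ mem_cl.2 (reach_mono (Finset.subset_insert _ _) h'))
  · intro h
    rw [key, h]
    · intro h'; exact hu (h ▸ mem_cl.2 h')
    · intro h'; exact hv (h ▸ mem_cl.2 h')

lemma lower_piv {p : ℝ} (h0 : 0 ≤ p) (h1 : p ≤ 1) (E : Finset (Sym2 V)) (x u v y : V) :
    T p E x u * T p E v y -
      ∑ w, M p E (fun s => ind (reach s x u ∧ reach s x w)) * (T p E v w * T p E w y) ≤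
    M p E (fun s => ind (reach s x u ∧ reach s v y ∧ ¬ reach s x v)) := by
  have sumind : ∀ (s : Finset (Sym2 V)) (F : Finset V → ℝ),
      ∑ S, ind (cl s x = S) * F S = F (cl s x) := by
    intro s F
    simp [ind]
  have a1 : M p E (fun s => ∑ S, (ind (cl s x = S) * ind (u ∈ S)) *
      ind (v ∉ S ∧ reach (filt (fun z => z ∉ S) s) v y)) ≤
      M p E (fun s => ind (reach s x u ∧ reach s v y ∧ ¬ reach s x v)) := by
    refine M_mono h0 h1 E fun s => ?_
    simp only [mul_assoc]
    rw [sumind s (fun S => ind (u ∈ S) *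
      ind (v ∉ S ∧ reach (filt (fun z => z ∉ S) s) v y)), ← ind_and]
    refine ind_mono ?_
    rintro ⟨a, b, c⟩
    exact ⟨mem_cl.1 a, reach_mono (filt_subset _ _) c, fun h => b (mem_cl.2 h)⟩
  have a2 : M p E (fun s => ∑ S, (ind (cl s x = S) * ind (u ∈ S)) *
      ind (v ∉ S ∧ reach (filt (fun z => z ∉ S) s) v y)) =
      ∑ S, M p E (fun s => ind (cl s x = S) * ind (u ∈ S)) *
        M p E (fun s => ind (v ∉ S ∧ reach (filt (fun z => z ∉ S) s) v y)) := by
    rw [M_sum]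
    refine Finset.sum_congr rfl fun S _ => ?_
    refine M_indep p (fun e => ¬ ∀ z ∈ e, z ∉ S) E _ _ ?_ ?_
    · intro e s he
      rw [ind_congr (cl_insert (not_not.1 he))]
    · intro e s he
      rw [filt, Finset.filter_insert, if_neg he, filt]
  have a3 : ∑ S, M p E (fun s => ind (cl s x = S) * ind (u ∈ S)) *
        (T p E v y - ∑ w ∈ S, T p E v w * T p E w y) ≤
      ∑ S, M p E (fun s => ind (cl s x = S) * ind (u ∈ S)) *
        M p E (fun s => ind (v ∉ S ∧ reach (filt (fun z => z ∉ S) s) v y)) := by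
    refine Finset.sum_le_sum fun S _ => mul_le_mul_of_nonneg_left (off_bound h0 h1 E v y S) ?_
    exact M_nonneg h0 h1 E fun s => mul_nonneg (ind_nonneg _) (ind_nonneg _)
  have a4 : ∑ S, M p E (fun s => ind (cl s x = S) * ind (u ∈ S)) *
        (T p E v y - ∑ w ∈ S, T p E v w * T p E w y) =
      M p E (fun s => ind (reach s x u) * T p E v y -
        ∑ w, ind (reach s x u ∧ reach s x w) * (T p E v w * T p E w y)) := by
    simp only [← M_mul', ← M_sum]
    congr 1
    funext s
    simp only [mul_assoc]
    rw [sumind s (fun S => ind (u ∈ S) * (T p E v y - ∑ w ∈ S, T p E v w * T p E w y)),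
      ind_congr mem_cl, mul_sub]
    congr 1
    rw [Finset.mul_sum, cl, Finset.sum_filter]
    refine Finset.sum_congr rfl fun w _ => ?_
    rw [ind_and]
    by_cases h : reach s x w
    · simp [h, ind]
    · simp [h, ind]
  rw [M_sub, M_mul', M_sum] at a4
  simp only [M_mul'] at a2 a3 a4
  have : M p E (fun s => ind (reach s x u)) = T p E x u := rfl
  rw [this] at a4
  linarith

lemma sum_edge {a b : V} (hab : a ≠ b) (φ : V → V → ℝ) :
    ∑ u, ∑ v, (if s(u, v) = s(a, b) then φ u v else 0) = φ a b + φ b a := by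
  have : ∀ u v, (if s(u, v) = s(a, b) then φ u v else 0) =
      (if u = a then (if v = b then φ u v else 0) else 0) +
      (if u = b then (if v = a then φ u v else 0) else 0) := by
    intro u v
    simp only [Sym2.eq_iff]
    by_cases h1 : u = a
    · subst h1
      by_cases h2 : v = b <;> simp [h2, hab]
    · by_cases h2 : u = b <;> by_cases h3 : v = a <;> simp [h1, h2, h3, hab.symm]
  simp only [this, Finset.sum_add_distrib]
  congr 1
  · rw [Finset.sum_eq_single a] <;> simp +contextual
  · rw [Finset.sum_eq_single b] <;> simp +contextual

lemma piv_upper {s : Finset (Sym2 V)} {a b x y : V} :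
    ind (reach (insert s(a, b) s) x y) - ind (reach (s.erase s(a, b)) x y) ≤
      ind (box (fun s => reach s x a) (fun s => reach s b y) s) +
      ind (box (fun s => reach s x b) (fun s => reach s a y) s) := by
  have n1 := ind_nonneg (box (fun s => reach s x a) (fun s => reach s b y) s)
  have n2 := ind_nonneg (box (fun s => reach s x b) (fun s => reach s a y) s)
  by_cases h : reach (s.erase s(a, b)) x y
  · have := ind_le_one (reach (insert s(a, b) s) x y)
    rw [ind_true h]
    linarith
  · rw [ind_false h]
    by_cases h' : reach (insert s(a, b) s) x y
    · rw [ind_true h']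
      have he : insert s(a, b) s = insert s(a, b) (s.erase s(a, b)) := by
        ext e; by_cases hh : e = s(a, b) <;> simp [hh]
      rw [he] at h'
      rcases reach_insert h' with h' | ⟨c, d⟩ | ⟨c, d⟩
      · exact absurd h' h
      · have := box_inc _ _ _ _ (Finset.erase_subset _ _)
          (reach_box c d fun hh => h (reach_trans hh d))
        rw [ind_true this] at n1 ⊢
        linarith
      · have := box_inc _ _ _ _ (Finset.erase_subset _ _)
          (reach_box c d fun hh => h (reach_trans hh d))
        rw [ind_true this] at n2 ⊢
        linarith
    · rw [ind_false h']; linarith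

lemma piv_lower {s : Finset (Sym2 V)} {a b x y : V} :
    ind (reach s x a ∧ reach s b y ∧ ¬ reach s x b) +
      ind (reach s x b ∧ reach s a y ∧ ¬ reach s x a) ≤
    ind (reach (insert s(a, b) s) x y) - ind (reach (s.erase s(a, b)) x y) := by
  have main : ∀ a b, reach s x a ∧ reach s b y ∧ ¬ reach s x b →
      reach (insert s(a, b) s) x y ∧ ¬ reach (s.erase s(a, b)) x y := by
    rintro a b ⟨h1, h2, h3⟩
    refine ⟨?_, fun h => h3 (reach_trans (reach_mono (Finset.erase_subset _ _) h)
      (reach_symm h2))⟩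
    have hs := Finset.subset_insert s(a, b) s
    exact reach_trans (reach_mono hs h1)
      (reach_trans (reach_edge (Finset.mem_insert_self _ _)) (reach_mono hs h2))
  have hge : ind (reach (s.erase s(a, b)) x y) ≤ ind (reach (insert s(a, b) s) x y) :=
    ind_mono (reach_mono ((Finset.erase_subset _ _).trans (Finset.subset_insert _ _)))
  by_cases h : reach s x a ∧ reach s b y ∧ ¬ reach s x b
  · have h' : ¬ (reach s x b ∧ reach s a y ∧ ¬ reach s x a) := fun hh => h.2.2 hh.1
    obtain ⟨c, d⟩ := main a b h
    rw [ind_true h, ind_false h', ind_true c, ind_false d]; norm_num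
  · by_cases h' : reach s x b ∧ reach s a y ∧ ¬ reach s x a
    · obtain ⟨c, d⟩ := main b a h'
      rw [Sym2.eq_swap] at c d
      rw [ind_true h', ind_false h, ind_true c, ind_false d]; norm_num
    · rw [ind_false h, ind_false h']; linarith

end Graph

section Main
variable {V : Type*} [Fintype V] [DecidableEq V]

def dT (p : ℝ) (E : Finset (Sym2 V)) (x y : V) : ℝ :=
  ∑ e ∈ E, M p E (fun s => ind (reach (insert e s) x y) - ind (reach (s.erase e) x y))

lemma T_deriv (p : ℝ) (E : Finset (Sym2 V)) (x y : V) :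
    HasDerivAt (fun p => T p E x y) (dT p E x y) p := M_deriv p E _

def kk (E : Finset (Sym2 V)) (u v : V) : ℝ := if s(u, v) ∈ E then 1 else 0

lemma kk_nonneg (E : Finset (Sym2 V)) (u v : V) : 0 ≤ kk E u v := by
  unfold kk; split_ifs <;> norm_num

lemma sum_edges {E : Finset (Sym2 V)} (hE : ∀ e ∈ E, ¬ e.IsDiag) (φ : V → V → ℝ)
    (g : Sym2 V → ℝ) (hg : ∀ a b, g s(a, b) = φ a b + φ b a) :
    ∑ e ∈ E, g e = ∑ u, ∑ v, kk E u v * φ u v := by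
  have : ∀ e ∈ E, g e = ∑ u, ∑ v, (if s(u, v) = e then φ u v else 0) := by
    intro e he
    induction e with
    | _ a b =>
      have hab : a ≠ b := fun h => hE _ he (by simp [h])
      rw [sum_edge hab, hg]
  rw [Finset.sum_congr rfl this, Finset.sum_comm]
  refine Finset.sum_congr rfl fun u _ => ?_
  rw [Finset.sum_comm]
  refine Finset.sum_congr rfl fun v _ => ?_
  rw [Finset.sum_ite_eq]
  simp [kk]

def sw (φ : V → V → ℝ) : Sym2 V → ℝ :=
  Sym2.lift ⟨fun a b => φ a b + φ b a, fun a b => add_comm _ _⟩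

lemma sw_mk (φ : V → V → ℝ) (a b : V) : sw φ s(a, b) = φ a b + φ b a := rfl

lemma dT_upper {p : ℝ} (h0 : 0 ≤ p) (h1 : p ≤ 1) {E : Finset (Sym2 V)}
    (hE : ∀ e ∈ E, ¬ e.IsDiag) (x y : V) :
    dT p E x y ≤ ∑ u, ∑ v, kk E u v * (T p E x u * T p E v y) := by
  rw [← sum_edges hE (fun u v => T p E x u * T p E v y) (sw _) (sw_mk _)]
  refine Finset.sum_le_sum fun e _ => ?_
  induction e with
  | _ a b =>
    rw [sw_mk]
    refine (M_mono h0 h1 E fun s => piv_upper).trans ?_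
    rw [M_add]
    exact add_le_add (BK' h0 h1 E (reach_inc _ _) (reach_inc _ _))
      (BK' h0 h1 E (reach_inc _ _) (reach_inc _ _))

lemma dT_lower {p : ℝ} (h0 : 0 ≤ p) (h1 : p ≤ 1) {E : Finset (Sym2 V)}
    (hE : ∀ e ∈ E, ¬ e.IsDiag) (x y : V) :
    ∑ u, ∑ v, kk E u v * (T p E x u * T p E v y -
      ∑ w, ∑ z, T p E x z * T p E w y * (T p E u z * T p E z w * T p E w v)) ≤ dT p E x y := by
  have key : ∀ u v, T p E x u * T p E v y -
      ∑ w, ∑ z, T p E x z * T p E w y * (T p E u z * T p E z w * T p E w v) ≤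
      M p E (fun s => ind (reach s x u ∧ reach s v y ∧ ¬ reach s x v)) := by
    intro u v
    refine le_trans ?_ (lower_piv h0 h1 E x u v y)
    refine sub_le_sub_left (Finset.sum_le_sum fun w _ => ?_) _
    refine (mul_le_mul_of_nonneg_right (tree_graph h0 h1 E x u w)
      (mul_nonneg (T_nonneg h0 h1 E v w) (T_nonneg h0 h1 E w y))).trans (le_of_eq ?_)
    rw [Finset.sum_mul]
    refine Finset.sum_congr rfl fun z _ => ?_
    rw [T_symm p E z u, T_symm p E v w]
    ring
  rw [← sum_edges hE (fun u v => T p E x u * T p E v y -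
      ∑ w, ∑ z, T p E x z * T p E w y * (T p E u z * T p E z w * T p E w v)) (sw _) (sw_mk _)]
  refine Finset.sum_le_sum fun e _ => ?_
  induction e with
  | _ a b =>
    rw [sw_mk]
    refine le_trans ?_ (M_mono h0 h1 E fun s => piv_lower)
    rw [M_add]
    exact add_le_add (key a b) (key b a)

lemma sum4 (F : V → V → V → V → ℝ) :
    ∑ x, ∑ y, ∑ u, ∑ v, F x y u v = ∑ u, ∑ v, ∑ x, ∑ y, F x y u v := by
  have : ∀ x, ∑ y, ∑ u, ∑ v, F x y u v = ∑ u, ∑ v, ∑ y, F x y u v := by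
    intro x
    rw [Finset.sum_comm]
    exact Finset.sum_congr rfl fun u _ => Finset.sum_comm
  simp only [this]
  rw [Finset.sum_comm]
  exact Finset.sum_congr rfl fun u _ => Finset.sum_comm

lemma sum_prod2 (f g : V → ℝ) (c : ℝ) : ∑ x, ∑ y, f x * g y * c = (∑ x, f x) * (∑ y, g y) * c := by
  simp only [← Finset.sum_mul, ← Finset.mul_sum]

lemma X_upper {p : ℝ} (h0 : 0 ≤ p) (h1 : p ≤ 1) {E : Finset (Sym2 V)}
    (hE : ∀ e ∈ E, ¬ e.IsDiag) {C : ℝ} (hC : ∀ x, ∑ y, T p E x y = C) :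
    ∑ x, ∑ y, dT p E x y ≤ C ^ 2 * ∑ u, ∑ v, kk E u v := by
  have hC' : ∀ y, ∑ x, T p E x y = C := fun y => by simp only [T_symm p E _ y, hC]
  refine (Finset.sum_le_sum fun x _ => Finset.sum_le_sum fun y _ =>
    dT_upper h0 h1 hE x y).trans (le_of_eq ?_)
  rw [sum4, Finset.mul_sum]
  refine Finset.sum_congr rfl fun u _ => ?_
  rw [Finset.mul_sum]
  refine Finset.sum_congr rfl fun v _ => ?_
  simp only [mul_comm (kk E u v)]
  rw [sum_prod2, hC, hC']
  ring

def tri (p : ℝ) (E : Finset (Sym2 V)) (u v : V) : ℝ :=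
  ∑ z, ∑ w, T p E u z * T p E z w * T p E w v

lemma X_lower {p : ℝ} (h0 : 0 ≤ p) (h1 : p ≤ 1) {E : Finset (Sym2 V)}
    (hE : ∀ e ∈ E, ¬ e.IsDiag) {C : ℝ} (hC : ∀ x, ∑ y, T p E x y = C) {nb : ℝ}
    (hnb : ∀ u v, s(u, v) ∈ E → tri p E u v ≤ nb) :
    (1 - nb) * C ^ 2 * ∑ u, ∑ v, kk E u v ≤ ∑ x, ∑ y, dT p E x y := by
  have hC' : ∀ y, ∑ x, T p E x y = C := fun y => by simp only [T_symm p E _ y, hC]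
  refine le_trans ?_ (Finset.sum_le_sum fun x _ => Finset.sum_le_sum fun y _ =>
    dT_lower h0 h1 hE x y)
  rw [sum4, Finset.mul_sum]
  refine Finset.sum_le_sum fun u _ => ?_
  rw [Finset.mul_sum]
  refine Finset.sum_le_sum fun v _ => ?_
  have e1 : ∑ x, ∑ y, T p E x u * T p E v y = C ^ 2 := by
    have := sum_prod2 (fun x => T p E x u) (fun y => T p E v y) 1
    simp only [mul_one, hC, hC'] at this
    rw [this]; ring
  have e2 : ∑ x, ∑ y, ∑ w, ∑ z, T p E x z * T p E w y * (T p E u z * T p E z w * T p E w v) =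
      C ^ 2 * tri p E u v := by
    rw [sum4, tri, Finset.sum_comm, Finset.mul_sum]
    refine Finset.sum_congr rfl fun z _ => ?_
    rw [Finset.mul_sum]
    refine Finset.sum_congr rfl fun w _ => ?_
    rw [sum_prod2, hC, hC']
    ring
  have e3 : ∑ x, ∑ y, kk E u v * (T p E x u * T p E v y -
      ∑ w, ∑ z, T p E x z * T p E w y * (T p E u z * T p E z w * T p E w v)) =
      kk E u v * (C ^ 2 - C ^ 2 * tri p E u v) := by
    rw [← e2]
    nth_rewrite 1 [← e1]
    simp only [Finset.mul_sum, Finset.sum_sub_distrib, mul_sub]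
  rw [e3]
  by_cases h : s(u, v) ∈ E
  · have := hnb u v h
    simp only [kk, h, if_true]
    nlinarith [sq_nonneg C]
  · simp [kk, h]

lemma tri_mono {p q : ℝ} (h0 : 0 ≤ p) (hpq : p ≤ q) (h1 : q ≤ 1) (E : Finset (Sym2 V))
    (u v : V) : tri p E u v ≤ tri q E u v := by
  have hT : ∀ x y, T p E x y ≤ T q E x y := fun x y =>
    M_mono_p (reach_inc x y) ⟨h0, hpq.trans h1⟩ ⟨h0.trans hpq, h1⟩ hpq
  have hp : ∀ x y, 0 ≤ T p E x y := T_nonneg h0 (hpq.trans h1) E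
  have hq : ∀ x y, 0 ≤ T q E x y := T_nonneg (h0.trans hpq) h1 E
  refine Finset.sum_le_sum fun z _ => Finset.sum_le_sum fun w _ => ?_
  exact mul_le_mul (mul_le_mul (hT _ _) (hT _ _) (hp _ _) (hq _ _)) (hT _ _) (hp _ _)
    (mul_nonneg (hq _ _) (hq _ _))

/-! ### Bridge to the frozen definitions -/
open Percolation

def EE (G : SimpleGraph V) : Finset (Sym2 V) :=
  (Finset.univ : Finset G.edgeSet).map (Function.Embedding.subtype _)

lemma mem_EE {G : SimpleGraph V} {e : Sym2 V} : e ∈ EE G ↔ e ∈ G.edgeSet := by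
  simp [EE]

def op (G : SimpleGraph V) (ω : Config G) : Finset (Sym2 V) :=
  (Finset.univ.filter (fun e : G.edgeSet => ω e = true)).map (Function.Embedding.subtype _)

lemma mem_op {G : SimpleGraph V} {ω : Config G} {e : Sym2 V} :
    e ∈ op G ω ↔ ∃ h : e ∈ G.edgeSet, ω ⟨e, h⟩ = true := by
  simp [op]

def cf (G : SimpleGraph V) (s : Finset (Sym2 V)) : Config G := fun e => decide (e.1 ∈ s)

lemma expect_eq (G : SimpleGraph V) (p : ℝ) (f : Finset (Sym2 V) → ℝ) :
    expect G p (fun ω => f (op G ω)) = M p (EE G) f := by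
  unfold expect M
  refine Finset.sum_bij' (fun ω _ => op G ω) (fun s _ => cf G s)
    ?_ ?_ ?_ ?_ ?_
  · intro ω _
    rw [Finset.mem_powerset]
    intro e he
    exact mem_EE.2 (mem_op.1 he).1
  · intro s _; exact Finset.mem_univ _
  · intro ω _
    funext e
    have : (e : Sym2 V) ∈ op G ω ↔ ω e = true := by
      rw [mem_op]
      exact ⟨fun ⟨_, h⟩ => h, fun h => ⟨e.2, h⟩⟩
    by_cases h : ω e = true
    · rw [h]; exact decide_eq_true (this.2 h)
    · rw [Bool.not_eq_true] at h
      rw [h]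
      exact decide_eq_false (fun h' => by rw [this.1 h'] at h; exact absurd h (by simp))
  · intro s hs
    ext e
    rw [mem_op]
    rw [Finset.mem_powerset] at hs
    constructor
    · rintro ⟨h, h'⟩; exact of_decide_eq_true h'
    · intro h; exact ⟨mem_EE.1 (hs h), decide_eq_true h⟩
  · intro ω _
    congr 1
    unfold weight EE
    rw [Finset.prod_map]
    refine Finset.prod_congr rfl fun e _ => ?_
    change _ = if (e : Sym2 V) ∈ op G ω then p else 1 - p
    have : (e : Sym2 V) ∈ op G ω ↔ ω e = true := by
      rw [mem_op]
      exact ⟨fun ⟨_, h⟩ => h, fun h => ⟨e.2, h⟩⟩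
    by_cases h : ω e = true
    · rw [if_pos h, if_pos (this.2 h)]
    · rw [if_neg h, if_neg (fun h' => h (this.1 h'))]

lemma occ_eq (G : SimpleGraph V) (ω : Config G) : occupied G ω = gr (op G ω) := by
  unfold occupied gr
  congr 1
  ext e
  rw [Finset.mem_coe, mem_op]
  rfl

lemma tau_eq (G : SimpleGraph V) (p : ℝ) (x y : V) : tau G p x y = T p (EE G) x y := by
  unfold T
  rw [← expect_eq]
  unfold tau prob expect
  refine Finset.sum_congr rfl fun ω _ => ?_
  simp only [occ_eq]
  by_cases h : (gr (op G ω)).Reachable x y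
  · rw [if_pos h, ind_true (P := reach (op G ω) x y) h, mul_one]
  · rw [if_neg h, ind_false (P := reach (op G ω) x y) h, mul_zero]

lemma triangle_eq (G : SimpleGraph V) (p : ℝ) (x y : V) :
    triangle G p x y = tri p (EE G) x y := by
  unfold triangle tri
  simp only [tau_eq]

lemma chi_eq (G : SimpleGraph V) (p : ℝ) (x : V) : chi G x p = ∑ y, T p (EE G) x y := by
  unfold T
  rw [← M_sum, ← expect_eq]
  unfold chi expect
  refine Finset.sum_congr rfl fun ω _ => ?_
  congr 1
  unfold cluster
  simp only [occ_eq]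
  rw [Finset.card_filter, Nat.cast_sum]
  refine Finset.sum_congr rfl fun y _ => ?_
  unfold ind reach
  push_cast
  congr

def symE (φ : V ≃ V) : Sym2 V ≃ Sym2 V where
  toFun := Sym2.map φ
  invFun := Sym2.map φ.symm
  left_inv e := by induction e with | _ a b => simp
  right_inv e := by induction e with | _ a b => simp

lemma reach_map (φ : V ≃ V) {s : Finset (Sym2 V)} {x y : V} (h : reach s x y) :
    reach (s.map (Equiv.toEmbedding (symE φ))) (φ x) (φ y) := by
  refine reach_ind (s := s) (y := y)
    (P := fun x => reach (s.map (Equiv.toEmbedding (symE φ))) (φ x) (φ y))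
    (reach_refl _ _) ?_ h
  intro a b hab _ hb
  refine reach_trans (reach_edge ?_) hb
  rw [Finset.mem_map]
  exact ⟨s(a, b), hab, rfl⟩

lemma chi_trans {G : SimpleGraph V} (htrans : IsTransitive G) (p : ℝ) (x y : V) :
    ∑ z, T p (EE G) x z = ∑ z, T p (EE G) y z := by
  obtain ⟨φ, rfl⟩ := htrans x y
  have hE : (EE G).map (Equiv.toEmbedding (symE φ.toEquiv)) = EE G := by
    ext e
    rw [Finset.mem_map]
    constructor
    · rintro ⟨e', he', rfl⟩
      induction e' with
      | _ a b =>
        rw [mem_EE] at he' ⊢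
        exact φ.map_adj_iff.2 he'
    · intro he
      induction e with
      | _ a b =>
        rw [mem_EE] at he
        refine ⟨s(φ.symm a, φ.symm b), mem_EE.2 (φ.symm.map_adj_iff.2 he), ?_⟩
        change s(φ (φ.symm a), φ (φ.symm b)) = _
        simp
  have key : ∀ z, T p (EE G) (φ x) (φ z) = T p (EE G) x z := by
    intro z
    unfold T
    conv_lhs => rw [← hE, M_map]
    congr 1
    funext s
    refine ind_congr ⟨fun h => ?_, fun h => reach_map φ.toEquiv h⟩
    have := reach_map φ.toEquiv.symm h
    have e1 : (s.map (Equiv.toEmbedding (symE φ.toEquiv))).map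
        (Equiv.toEmbedding (symE φ.toEquiv.symm)) = s := by
      ext e
      simp only [Finset.mem_map, exists_exists_and_eq_and]
      have hc : ∀ e : Sym2 V, (Equiv.toEmbedding (symE φ.toEquiv.symm))
          ((Equiv.toEmbedding (symE φ.toEquiv)) e) = e :=
        fun e => (symE φ.toEquiv).symm_apply_apply e
      simp only [hc, exists_eq_right]
    rw [e1] at this
    change reach s (φ.toEquiv.symm (φ.toEquiv x)) (φ.toEquiv.symm (φ.toEquiv z)) at this
    rwa [Equiv.symm_apply_apply, Equiv.symm_apply_apply] at this
  rw [← Equiv.sum_comp φ.toEquiv (fun z => T p (EE G) (φ x) z)]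
  exact Finset.sum_congr rfl fun z _ => (key z).symm

end Main

lemma sum_kk {V : Type*} [Fintype V] [DecidableEq V]
    (G : SimpleGraph V) [DecidableRel G.Adj] (Ω : ℕ) (hreg : G.IsRegularOfDegree Ω) :
    ∑ u, ∑ v, kk (EE G) u v = (Fintype.card V : ℝ) * Ω := by
  have : ∀ u : V, ∑ v, kk (EE G) u v = Ω := by
    intro u
    rw [← hreg u, ← SimpleGraph.card_neighborFinset_eq_degree,
      SimpleGraph.neighborFinset_eq_filter, Finset.card_filter, Nat.cast_sum]
    refine Finset.sum_congr rfl fun v _ => ?_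
    unfold kk
    by_cases h : G.Adj u v
    · rw [if_pos (mem_EE.2 h), if_pos h]; norm_num
    · rw [if_neg (fun h' => h (mem_EE.1 h')), if_neg h]; norm_num
  simp [this]

open Percolation in
lemma chi_diff {V : Type*} [Fintype V] [DecidableEq V]
    (G : SimpleGraph V) [DecidableRel G.Adj] (htrans : IsTransitive G)
    (Ω : ℕ) (hreg : G.IsRegularOfDegree Ω) (x₀ : V) (p : ℝ) :
    ∃ d, HasDerivAt (chi G x₀) d p ∧
      (0 ≤ p → p ≤ 1 → d ≤ Ω * (chi G x₀ p) ^ 2) ∧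
      (∀ q, 0 ≤ p → p ≤ q → q ≤ 1 → (1 - nablaBar G q) * (Ω * (chi G x₀ p) ^ 2) ≤ d) := by
  have hV : (0 : ℝ) < Fintype.card V := by
    have : 0 < Fintype.card V := Fintype.card_pos_iff.2 ⟨x₀⟩
    exact_mod_cast this
  have hC : ∀ p x, ∑ y, T p (EE G) x y = chi G x₀ p := fun p x => by
    rw [chi_eq, chi_trans htrans]
  have hfun : chi G x₀ = fun p => (∑ x, ∑ y, T p (EE G) x y) / Fintype.card V := by
    funext p
    simp only [hC]
    simp only [Finset.sum_const, Finset.card_univ, nsmul_eq_mul]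
    field_simp
  have hE : ∀ e ∈ EE G, ¬ e.IsDiag := fun e he =>
    SimpleGraph.not_isDiag_of_mem_edgeSet G (mem_EE.1 he)
  refine ⟨(∑ x, ∑ y, dT p (EE G) x y) / Fintype.card V, ?_, ?_, ?_⟩
  · rw [hfun]
    refine HasDerivAt.div_const ?_ _
    exact HasDerivAt.fun_sum fun x _ => HasDerivAt.fun_sum fun y _ => T_deriv p (EE G) x y
  · intro h0 h1
    have := X_upper h0 h1 hE (hC p)
    rw [sum_kk G Ω hreg] at this
    rw [div_le_iff₀ hV]
    linarith
  · intro q h0 hpq h1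
    have hfin : BddAbove {t : ℝ | ∃ x y : V, G.Adj x y ∧ t = triangle G q x y} := by
      refine Set.Finite.bddAbove (Set.Finite.subset
        (Set.finite_range (fun z : V × V => triangle G q z.1 z.2)) ?_)
      rintro t ⟨x, y, -, rfl⟩
      exact ⟨(x, y), rfl⟩
    have hnb : ∀ u v, s(u, v) ∈ EE G → tri p (EE G) u v ≤ nablaBar G q := by
      intro u v h
      refine (tri_mono h0 hpq h1 (EE G) u v).trans ?_
      rw [← triangle_eq]
      exact le_csSup hfin ⟨u, v, mem_EE.1 h, rfl⟩
    have := X_lower h0 (hpq.trans h1) hE (hC p) hnb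
    rw [sum_kk G Ω hreg] at this
    rw [le_div_iff₀ hV]
    linarith

open Percolation in
lemma chi_mono {V : Type*} [Fintype V] [DecidableEq V] (G : SimpleGraph V) (x₀ : V) {p q : ℝ}
    (h0 : 0 ≤ p) (hpq : p ≤ q) (h1 : q ≤ 1) : chi G x₀ p ≤ chi G x₀ q := by
  rw [chi_eq, chi_eq]
  exact Finset.sum_le_sum fun y _ =>
    M_mono_p (reach_inc x₀ y) ⟨h0, hpq.trans h1⟩ ⟨h0.trans hpq, h1⟩ hpq

open Percolation in
lemma chi_pos {V : Type*} [Fintype V] [DecidableEq V] (G : SimpleGraph V) (x₀ : V) {p : ℝ}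
    (h0 : 0 ≤ p) (h1 : p ≤ 1) : 0 < chi G x₀ p := by
  rw [chi_eq]
  have := Finset.single_le_sum (f := fun y => T p (EE G) x₀ y)
    (fun y _ => T_nonneg h0 h1 (EE G) x₀ y) (Finset.mem_univ x₀)
  simp only [T_self] at this
  linarith

end PercAux

open Percolation in
/-- Theorem 1.1(ii): the width of the interval between two susceptibility levels. -/
theorem window_width
    {V : Type*} [Fintype V] [DecidableEq V]
    (G : SimpleGraph V) [DecidableRel G.Adj]
    (hconn : G.Connected) (htrans : IsTransitive G)
    (Ω : ℕ) (hreg : G.IsRegularOfDegree Ω)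
    (x₀ : V)
    (lam₁ lam₂ : ℝ) (hlam₁ : 0 < lam₁) (hlam₁₂ : lam₁ < lam₂)
    (h1V : 1 < lam₁ * (Fintype.card V : ℝ) ^ ((1 : ℝ) / 3))
    (h1V' : lam₁ * (Fintype.card V : ℝ) ^ ((1 : ℝ) / 3) < (Fintype.card V : ℝ))
    (h2V : 1 < lam₂ * (Fintype.card V : ℝ) ^ ((1 : ℝ) / 3))
    (h2V' : lam₂ * (Fintype.card V : ℝ) ^ ((1 : ℝ) / 3) < (Fintype.card V : ℝ))
    (p₁ p₂ : ℝ) (hp₁0 : 0 < p₁) (hp₁1 : p₁ < 1) (hp₂0 : 0 < p₂) (hp₂1 : p₂ < 1)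
    (hp₁ : chi G x₀ p₁ = lam₁ * (Fintype.card V : ℝ) ^ ((1 : ℝ) / 3))
    (hp₂ : chi G x₀ p₂ = lam₂ * (Fintype.card V : ℝ) ^ ((1 : ℝ) / 3))
    (hnb : nablaBar G p₂ < 1) :
    (lam₂ - lam₁) / (lam₁ * lam₂) * ((Fintype.card V : ℝ) ^ ((1 : ℝ) / 3))⁻¹ ≤
        (Ω : ℝ) * (p₂ - p₁) ∧
      (Ω : ℝ) * (p₂ - p₁) ≤
        (1 / (1 - nablaBar G p₂)) * ((lam₂ - lam₁) / (lam₁ * lam₂)) *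
          ((Fintype.card V : ℝ) ^ ((1 : ℝ) / 3))⁻¹ := by
  classical
  set r : ℝ := (Fintype.card V : ℝ) ^ ((1 : ℝ) / 3) with hr
  set nb := nablaBar G p₂ with hnbdef
  have hlam₂ : 0 < lam₂ := hlam₁.trans hlam₁₂
  have hrpos : 0 < r := by
    by_contra h
    nlinarith
  have hlt : p₁ < p₂ := by
    by_contra h
    have := PercAux.chi_mono G x₀ hp₂0.le (not_lt.1 h) hp₁1.le
    rw [hp₁, hp₂] at this
    nlinarith
  choose d hd hup hlow using PercAux.chi_diff G htrans Ω hreg x₀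
  have hpos : ∀ p ∈ Set.Icc p₁ p₂, 0 < chi G x₀ p := fun p hp =>
    PercAux.chi_pos G x₀ (hp₁0.le.trans hp.1) (hp.2.trans hp₂1.le)
  have hder : ∀ c : ℝ, ∀ p ∈ Set.Icc p₁ p₂,
      HasDerivAt (fun p => c * p + (chi G x₀ p)⁻¹) (c + -d p / (chi G x₀ p) ^ 2) p := by
    intro c p hp
    have h1 : HasDerivAt (fun p : ℝ => c * p) c p := by
      simpa using (hasDerivAt_id p).const_mul c
    exact h1.add ((hd p).fun_inv (hpos p hp).ne')
  have hm1 : MonotoneOn (fun p => (Ω : ℝ) * p + (chi G x₀ p)⁻¹) (Set.Icc p₁ p₂) := by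
    refine monotoneOn_of_deriv_nonneg (convex_Icc _ _)
      (fun p hp => (hder _ p hp).continuousAt.continuousWithinAt)
      (fun p hp => (hder _ p (interior_subset hp)).differentiableAt.differentiableWithinAt) ?_
    intro p hp
    have hp' := interior_subset hp
    rw [(hder _ p hp').deriv]
    have h := hup p (hp₁0.le.trans hp'.1) (hp'.2.trans hp₂1.le)
    have hc : 0 < (chi G x₀ p) ^ 2 := pow_pos (hpos p hp') 2
    have : d p / (chi G x₀ p) ^ 2 ≤ Ω := by rwa [div_le_iff₀ hc]
    rw [neg_div]
    linarith
  have hm2 : AntitoneOn (fun p => ((1 - nb) * Ω : ℝ) * p + (chi G x₀ p)⁻¹) (Set.Icc p₁ p₂) := by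
    refine antitoneOn_of_deriv_nonpos (convex_Icc _ _)
      (fun p hp => (hder _ p hp).continuousAt.continuousWithinAt)
      (fun p hp => (hder _ p (interior_subset hp)).differentiableAt.differentiableWithinAt) ?_
    intro p hp
    have hp' := interior_subset hp
    rw [(hder _ p hp').deriv]
    have h := hlow p p₂ (hp₁0.le.trans hp'.1) hp'.2 hp₂1.le
    have hc : 0 < (chi G x₀ p) ^ 2 := pow_pos (hpos p hp') 2
    have : (1 - nb) * Ω ≤ d p / (chi G x₀ p) ^ 2 := by
      rw [le_div_iff₀ hc]
      linarith
    rw [neg_div]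
    linarith
  have e1 := hm1 (Set.left_mem_Icc.2 hlt.le) (Set.right_mem_Icc.2 hlt.le) hlt.le
  have e2 := hm2 (Set.left_mem_Icc.2 hlt.le) (Set.right_mem_Icc.2 hlt.le) hlt.le
  simp only [hp₁, hp₂] at e1 e2
  have e3 : (lam₁ * r)⁻¹ - (lam₂ * r)⁻¹ = (lam₂ - lam₁) / (lam₁ * lam₂) * r⁻¹ := by
    field_simp
  have hnb' : 0 < 1 - nb := by linarith
  constructor
  · rw [← e3]; linarith
  · rw [mul_assoc, ← e3, one_div, inv_mul_eq_div, le_div_iff₀ hnb']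
    linarith
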